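/- Let D be a connected C-homogeneous digraph with more than one end, let 𝒞 be a basic cut system of D, and let S be a 𝒞-separator. Then there is no edge (x,y) of D with both vertices x and y in S. -/

import Mathlib

open Set

universe u

/-- The underlying undirected graph of a digraph given by its edge relation. -/
def UG {V : Type u} (E : V → V → Prop) : SimpleGraph V := SimpleGraph.fromRel E

/-- `E` is a digraph edge relation: irreflexive and antisymmetric. -/
def IsDigraph {V : Type u} (E : V → V → Prop) : Prop :=
  (∀ x, ¬ E x x) ∧ ∀ x y, E x y → ¬ E y x

/-- A ray in a graph: a one-way infinite path. -/
def IsRay {V : Type u} (G : SimpleGraph V) (r : ℕ → V) : Prop :=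
  Function.Injective r ∧ ∀ n, G.Adj (r n) (r (n + 1))

/-- A sequence is eventually in a set. -/
def EventuallyIn {V : Type u} (r : ℕ → V) (C : Set V) : Prop :=
  ∃ N, ∀ n, N ≤ n → r n ∈ C

/-- `C` is a connected component of the subgraph of `G` induced on `W`:
a maximal connected subset of `W`. -/
def IsCompOf {V : Type u} (G : SimpleGraph V) (C W : Set V) : Prop :=
  C.Nonempty ∧ C ⊆ W ∧ (G.induce C).Connected ∧
    ∀ C', C ⊆ C' → C' ⊆ W → (G.induce C').Connected → C' = C

/-- Two rays are equivalent if for every finite vertex set `S` they lie eventually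
in the same component of the graph minus `S`. -/
def RayEquiv {V : Type u} (G : SimpleGraph V) (r r' : ℕ → V) : Prop :=
  ∀ S : Finset V, ∃ C : Set V, IsCompOf G C {v | v ∉ S} ∧
    EventuallyIn r C ∧ EventuallyIn r' C

/-- The graph has more than one end: two inequivalent rays. -/
def MoreThanOneEnd {V : Type u} (G : SimpleGraph V) : Prop :=
  ∃ r r' : ℕ → V, IsRay G r ∧ IsRay G r' ∧ ¬ RayEquiv G r r'

/-- The graph has infinitely many ends: arbitrarily large families of pairwise
inequivalent rays. -/
def InfinitelyManyEnds {V : Type u} (G : SimpleGraph V) : Prop :=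
  ∀ n : ℕ, ∃ f : Fin n → (ℕ → V), (∀ i, IsRay G (f i)) ∧
    ∀ i j, i ≠ j → ¬ RayEquiv G (f i) (f j)

/-- A separation of a graph: a pair of vertex sets covering `V` such that every
edge lies within one side. -/
def IsSeparation {V : Type u} (G : SimpleGraph V) (c : Set V × Set V) : Prop :=
  c.1 ∪ c.2 = univ ∧ ∀ x y, G.Adj x y → (x ∈ c.1 ∧ y ∈ c.1) ∨ (x ∈ c.2 ∧ y ∈ c.2)

/-- The order of a separation: the number of vertices in its separator. -/
noncomputable def sepOrder {V : Type u} (c : Set V × Set V) : ℕ := (c.1 ∩ c.2).ncard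

/-- The neighbourhood of a vertex set. -/
def Nbhd {V : Type u} (G : SimpleGraph V) (A : Set V) : Set V :=
  {v | v ∉ A ∧ ∃ u ∈ A, G.Adj u v}

/-- The separation `(A, ∼)`. -/
def tildeSep {V : Type u} (G : SimpleGraph V) (A : Set V) : Set V × Set V :=
  (A, Aᶜ ∪ Nbhd G Aᶜ)

/-- `S` separates the wings of the separation `c`: every walk from one wing to
the other meets `S`. -/
def SeparatesWings {V : Type u} (G : SimpleGraph V) (c : Set V × Set V) (S : Set V) : Prop :=
  ∀ a ∈ c.1 \ c.2, ∀ b ∈ c.2 \ c.1, ∀ w : G.Walk a b, ∃ v ∈ w.support, v ∈ S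

/-- A separation of finite order with non-empty wings is essential if its first wing is
connected and no proper subset of the separator separates the wings. -/
def IsEssential {V : Type u} (G : SimpleGraph V) (c : Set V × Set V) : Prop :=
  IsSeparation G c ∧ (c.1 ∩ c.2).Finite ∧ (c.1 \ c.2).Nonempty ∧ (c.2 \ c.1).Nonempty ∧
  (G.induce (c.1 \ c.2)).Connected ∧
  ∀ S, S ⊂ c.1 ∩ c.2 → ¬ SeparatesWings G c S

/-- `C` is a wing of some separation in `𝒞`. -/
def IsWingOf {V : Type u} (𝒞 : Set (Set V × Set V)) (C : Set V) : Prop :=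
  ∃ d ∈ 𝒞, C = d.1 \ d.2 ∨ C = d.2 \ d.1

/-- A cut system. -/
def IsCutSystem {V : Type u} (G : SimpleGraph V) (𝒞 : Set (Set V × Set V)) : Prop :=
  𝒞.Nonempty ∧ (∀ c ∈ 𝒞, IsEssential G c) ∧
  (∀ c ∈ 𝒞, ∃ d ∈ 𝒞, d.1 ⊆ c.2) ∧
  (∀ c ∈ 𝒞, ∀ C : Set V, IsCompOf G C (c.2 \ c.1) →
    (∃ d ∈ 𝒞, d.1 \ d.2 ⊆ C) → tildeSep G (C ∪ Nbhd G C) ∈ 𝒞) ∧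
  (∀ c ∈ 𝒞, ∀ c' ∈ 𝒞, ∃ C₁ C₂ : Set V,
    ((IsCompOf G C₁ ((c.1 \ c.2) ∩ (c'.1 \ c'.2)) ∧
      IsCompOf G C₂ ((c.2 \ c.1) ∩ (c'.2 \ c'.1))) ∨
     (IsCompOf G C₁ ((c.2 \ c.1) ∩ (c'.1 \ c'.2)) ∧
      IsCompOf G C₂ ((c.1 \ c.2) ∩ (c'.2 \ c'.1)))) ∧
    IsWingOf 𝒞 C₁ ∧ IsWingOf 𝒞 C₂)

/-- Pick a side of a separation. -/
def pickSide {V : Type u} (c : Set V × Set V) : Bool → Set V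
  | false => c.1
  | true => c.2

/-- Two cuts are nested (with respect to the cut system `𝒞`). -/
def NestedPair {V : Type u} (G : SimpleGraph V) (𝒞 : Set (Set V × Set V))
    (c d : Set V × Set V) : Prop :=
  ∃ i j : Bool,
    ((¬ ∃ C, IsCompOf G C ((tildeSep G (pickSide c i ∩ pickSide d j)).1 \
        (tildeSep G (pickSide c i ∩ pickSide d j)).2) ∧
        tildeSep G (C ∪ Nbhd G C) ∈ 𝒞) ∨
     (¬ ∃ C, IsCompOf G C ((tildeSep G (pickSide c i ∩ pickSide d j)).2 \
        (tildeSep G (pickSide c i ∩ pickSide d j)).1) ∧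
        tildeSep G (C ∪ Nbhd G C) ∈ 𝒞)) ∧
    (c.1 ∩ c.2) ∪ (d.1 ∩ d.2) ⊆ pickSide c (!i) ∩ pickSide d (!j)

/-- A cut system is nested if each two of its cuts are nested. -/
def IsNestedSystem {V : Type u} (G : SimpleGraph V) (𝒞 : Set (Set V × Set V)) : Prop :=
  ∀ c ∈ 𝒞, ∀ d ∈ 𝒞, NestedPair G 𝒞 c d

/-- `S` is a `𝒞`-separator. -/
def IsSeparatorOf {V : Type u} (𝒞 : Set (Set V × Set V)) (S : Set V) : Prop :=
  ∃ c ∈ 𝒞, c.1 ∩ c.2 = S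

/-- A vertex set contains an end: some ray lies in it. -/
def ContainsEnd {V : Type u} (G : SimpleGraph V) (A : Set V) : Prop :=
  ∃ r : ℕ → V, IsRay G r ∧ ∀ n, r n ∈ A

/-- A basic cut system. -/
def IsBasic {V : Type u} (G : SimpleGraph V) (𝒞 : Set (Set V × Set V)) : Prop :=
  IsCutSystem G 𝒞 ∧
  (∀ c ∈ 𝒞, ∀ d ∈ 𝒞, ¬ sepOrder c < sepOrder d) ∧
  IsNestedSystem G 𝒞 ∧
  (∀ φ : G ≃g G, ∀ c ∈ 𝒞, ((⇑φ '' c.1, ⇑φ '' c.2) : Set V × Set V) ∈ 𝒞) ∧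
  (∀ S S' : Set V, IsSeparatorOf 𝒞 S → IsSeparatorOf 𝒞 S' → ∃ φ : G ≃g G, ⇑φ '' S = S') ∧
  (∀ c ∈ 𝒞, ContainsEnd G c.1 ∧ ContainsEnd G c.2 ∧
    ¬ ∃ d : Set V × Set V, IsSeparation G d ∧ (d.1 ∩ d.2).Finite ∧
      (d.1 ∩ d.2).ncard < sepOrder c ∧ ContainsEnd G d.1 ∧ ContainsEnd G d.2)

/-- The defining property of a `𝒞`-block. -/
def BlockProp {V : Type u} (𝒞 : Set (Set V × Set V)) (X : Set V) : Prop :=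
  (∀ c ∈ 𝒞, (X ⊆ c.1 ∨ X ⊆ c.2) ∧ ¬ (X ⊆ c.1 ∧ X ⊆ c.2)) ∧
  ∃ c ∈ 𝒞, X ⊆ c.1 ∧ c.1 ∩ c.2 ⊆ X

/-- A `𝒞`-block: a maximal vertex set with the block property. -/
def IsCBlock {V : Type u} (𝒞 : Set (Set V × Set V)) (X : Set V) : Prop :=
  BlockProp 𝒞 X ∧ ∀ X', X ⊆ X' → BlockProp 𝒞 X' → X' = X

/-- A digraph is C-homogeneous: every isomorphism between finite induced
subdigraphs with connected underlying graphs extends to an automorphism. -/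
def DigraphCHom {V : Type u} (E : V → V → Prop) : Prop :=
  ∀ (X Y : Set V), X.Finite → Y.Finite → ((UG E).induce X).Connected →
  ∀ φ : X ≃ Y, (∀ a b : X, E a.1 b.1 ↔ E (φ a).1 (φ b).1) →
  ∃ ψ : Equiv.Perm V, (∀ x y, E (ψ x) (ψ y) ↔ E x y) ∧ ∀ a : X, ψ a.1 = (φ a).1

/-- A graph is C-homogeneous: every isomorphism between finite connected induced
subgraphs extends to an automorphism. -/
def GraphCHom {V : Type u} (G : SimpleGraph V) : Prop :=
  ∀ (X Y : Set V), X.Finite → Y.Finite → (G.induce X).Connected →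
  ∀ φ : X ≃ Y, (∀ a b : X, G.Adj a.1 b.1 ↔ G.Adj (φ a).1 (φ b).1) →
  ∃ ψ : G ≃g G, ∀ a : X, ψ a.1 = (φ a).1

/-- The digraph contains a triangle: three pairwise adjacent vertices. -/
def HasTriangle {V : Type u} (E : V → V → Prop) : Prop :=
  ∃ x y z : V, (UG E).Adj x y ∧ (UG E).Adj y z ∧ (UG E).Adj x z

/-- An `n`-arc: a directed path `p 0, p 1, …, p n`. -/
def IsArc {V : Type u} (E : V → V → Prop) (n : ℕ) (p : ℕ → V) : Prop :=
  (∀ i j, i ≤ n → j ≤ n → p i = p j → i = j) ∧ ∀ i < n, E (p i) (p (i + 1))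

/-- A digraph is highly-arc-transitive: for every `n`, its automorphism group acts
transitively on `n`-arcs. -/
def HighlyArcTransitive {V : Type u} (E : V → V → Prop) : Prop :=
  ∀ n : ℕ, ∀ p q : ℕ → V, IsArc E n p → IsArc E n q →
  ∃ ψ : Equiv.Perm V, (∀ x y, E (ψ x) (ψ y) ↔ E x y) ∧ ∀ i ≤ n, ψ (p i) = q i

/-- An alternating walk `w 0, …, w n` in a digraph. -/
def IsAltWalk {V : Type u} (E : V → V → Prop) (n : ℕ) (w : ℕ → V) : Prop :=
  (∀ i < n, E (w i) (w (i + 1)) ∨ E (w (i + 1)) (w i)) ∧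
  ∀ i, i + 2 ≤ n → (E (w i) (w (i + 1)) ↔ E (w (i + 2)) (w (i + 1)))

/-- The edge `e` lies on the walk `w 0, …, w n` (in either direction). -/
def EdgeOnWalk {V : Type u} (n : ℕ) (w : ℕ → V) (e : V × V) : Prop :=
  ∃ i < n, (w i = e.1 ∧ w (i + 1) = e.2) ∨ (w i = e.2 ∧ w (i + 1) = e.1)

/-- Two edges are reachable from each other: they lie on a common alternating walk. -/
def Reach {V : Type u} (E : V → V → Prop) (e f : V × V) : Prop :=
  ∃ n w, IsAltWalk E n w ∧ EdgeOnWalk n w e ∧ EdgeOnWalk n w f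

/-- The edge relation of the reachability digraph `Δ_e`. -/
def DeltaRel {V : Type u} (E : V → V → Prop) (e : V × V) : V → V → Prop :=
  fun x y => E x y ∧ Reach E e (x, y)

/-- The underlying undirected graph of the reachability digraph `Δ_e`. -/
def DeltaGraph {V : Type u} (E : V → V → Prop) (e : V × V) : SimpleGraph V :=
  UG (DeltaRel E e)

/-- Tails of edges of `𝒜(e)`. -/
def Tails {V : Type u} (E : V → V → Prop) (e : V × V) : Set V :=
  {x | ∃ y, DeltaRel E e x y}

/-- Heads of edges of `𝒜(e)`. -/
def Heads {V : Type u} (E : V → V → Prop) (e : V × V) : Set V :=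
  {y | ∃ x, DeltaRel E e x y}

/-- The set of descendants of a vertex. -/
def Descendants {V : Type u} (E : V → V → Prop) (x : V) : Set V :=
  {y | ∃ n p, IsArc E n p ∧ p 0 = x ∧ p n = y}

/-- `(X, Y)` is a bipartition of the graph `G`. -/
def IsBipartition {V : Type u} (G : SimpleGraph V) (X Y : Set V) : Prop :=
  X ∪ Y = univ ∧ Disjoint X Y ∧
  ∀ a b, G.Adj a b → (a ∈ X ∧ b ∈ Y) ∨ (a ∈ Y ∧ b ∈ X)

/-- `G` with sides `X`, `Y` is C-homogeneous bipartite: every isomorphism between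
finite connected induced subgraphs preserving the sides extends to a side-preserving
automorphism. -/
def BipCHom {V : Type u} (G : SimpleGraph V) (X Y : Set V) : Prop :=
  ∀ (A B : Set V), A.Finite → B.Finite → (G.induce A).Connected →
  ∀ φ : A ≃ B, (∀ a b : A, G.Adj a.1 b.1 ↔ G.Adj (φ a).1 (φ b).1) →
  (∀ a : A, a.1 ∈ X ↔ (φ a).1 ∈ X) → (∀ a : A, a.1 ∈ Y ↔ (φ a).1 ∈ Y) →
  ∃ ψ : G ≃g G, (∀ v, v ∈ X ↔ ψ v ∈ X) ∧ (∀ v, v ∈ Y ↔ ψ v ∈ Y) ∧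
    ∀ a : A, ψ a.1 = (φ a).1

/-- `G` with sides `X`, `Y` is homogeneous bipartite: every isomorphism between
finite induced subgraphs preserving the sides extends to a side-preserving
automorphism. -/
def BipHom {V : Type u} (G : SimpleGraph V) (X Y : Set V) : Prop :=
  ∀ (A B : Set V), A.Finite → B.Finite →
  ∀ φ : A ≃ B, (∀ a b : A, G.Adj a.1 b.1 ↔ G.Adj (φ a).1 (φ b).1) →
  (∀ a : A, a.1 ∈ X ↔ (φ a).1 ∈ X) → (∀ a : A, a.1 ∈ Y ↔ (φ a).1 ∈ Y) →
  ∃ ψ : G ≃g G, (∀ v, v ∈ X ↔ ψ v ∈ X) ∧ (∀ v, v ∈ Y ↔ ψ v ∈ Y) ∧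
    ∀ a : A, ψ a.1 = (φ a).1

/-- `G` with sides `X`, `Y` is generic bipartite. -/
def GenericBip {V : Type u} (G : SimpleGraph V) (X Y : Set V) : Prop :=
  (∀ U W : Set V, U ⊆ X → W ⊆ X → U.Finite → W.Finite → Disjoint U W →
    ∃ v ∈ Y, (∀ u ∈ U, G.Adj v u) ∧ ∀ w ∈ W, ¬ G.Adj v w) ∧
  (∀ U W : Set V, U ⊆ Y → W ⊆ Y → U.Finite → W.Finite → Disjoint U W →
    ∃ v ∈ X, (∀ u ∈ U, G.Adj v u) ∧ ∀ w ∈ W, ¬ G.Adj v w)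

/-- Any two vertices of the nonempty set `K` are joined by a walk inside `K`. -/
def WalkConnected {V : Type u} (G : SimpleGraph V) (K : Set V) : Prop :=
  K.Nonempty ∧ ∀ u ∈ K, ∀ v ∈ K, ∃ w : G.Walk u v, ∀ p ∈ w.support, p ∈ K

/-- `C` and `D` are end-containing components of the complement of a `𝒞`-separator, one of them
being the connected wing of a cut. -/
def IsFullPair {V : Type u} (G : SimpleGraph V) (𝒞 : Set (Set V × Set V)) (C D : Set V) : Prop :=
  ∃ c ∈ 𝒞, ((C = c.1 \ c.2 ∧ D ⊆ c.2 \ c.1) ∨ (D = c.1 \ c.2 ∧ C ⊆ c.2 \ c.1)) ∧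
    (WalkConnected G C ∧ Nbhd G C = c.1 ∩ c.2 ∧ ContainsEnd G C) ∧
    WalkConnected G D ∧ Nbhd G D = c.1 ∩ c.2 ∧ ContainsEnd G D

section Connectivity

variable {V : Type u} {G : SimpleGraph V}

theorem walkConnected_of_induce {K : Set V} (h : (G.induce K).Connected) : WalkConnected G K := by
  refine ⟨?_, fun u hu v hv => ?_⟩
  · obtain ⟨a⟩ := h.nonempty
    exact ⟨a.1, a.2⟩
  · obtain ⟨w⟩ := h.preconnected ⟨u, hu⟩ ⟨v, hv⟩
    refine ⟨w.map (SimpleGraph.Embedding.induce K).toHom, fun p hp => ?_⟩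
    obtain ⟨a, -, rfl⟩ := List.mem_map.1
      (show p ∈ w.support.map (SimpleGraph.Embedding.induce K).toHom from
        SimpleGraph.Walk.support_map _ w ▸ hp)
    exact a.2

theorem exists_mem_support_nbhd {C : Set V} {a b : V} (w : G.Walk a b) (ha : a ∈ C)
    (hb : b ∉ C) : ∃ v ∈ w.support, v ∈ Nbhd G C := by
  induction w with
  | nil => exact absurd ha hb
  | @cons u v _ h p ih =>
    by_cases hv : v ∈ C
    · obtain ⟨t, ht, htC⟩ := ih hv hb
      exact ⟨t, by simp [ht], htC⟩
    · exact ⟨v, by simp, hv, u, ha, h⟩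

theorem WalkConnected.subset {K C : Set V} (hK : WalkConnected G K) {a : V} (haK : a ∈ K)
    (haC : a ∈ C) (h : ∀ v ∈ K, v ∉ Nbhd G C) : K ⊆ C := by
  intro b hb
  by_contra hbC
  obtain ⟨w, hw⟩ := hK.2 a haK b hb
  obtain ⟨v, hv, hvC⟩ := exists_mem_support_nbhd w haC hbC
  exact h v (hw v hv) hvC

theorem nbhd_subset_union {C D : Set V} (h : C ⊆ D) : Nbhd G C ⊆ D ∪ Nbhd G D := by
  rintro v ⟨-, u, hu, huv⟩
  by_cases hv : v ∈ D
  · exact Or.inl hv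
  · exact Or.inr ⟨hv, u, h hu, huv⟩

theorem mem_of_adj {C : Set V} {u v : V} (hu : u ∈ C) (h : G.Adj u v) (hv : v ∉ Nbhd G C) :
    v ∈ C := by
  by_contra hvC
  exact hv ⟨hvC, u, hu, h⟩

/-- A connected subset of `W` is contained in a connected subset of `W` without
neighbours in `W`. -/
theorem WalkConnected.exists_component {K W : Set V} (hK : WalkConnected G K) (hKW : K ⊆ W) :
    ∃ K', K ⊆ K' ∧ K' ⊆ W ∧ WalkConnected G K' ∧ Disjoint (Nbhd G K') W := by
  obtain ⟨u, hu⟩ := hK.1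
  let K' : Set V := {v | ∃ w : G.Walk u v, ∀ p ∈ w.support, p ∈ W}
  have hsupp : ∀ v (w : G.Walk u v), (∀ p ∈ w.support, p ∈ W) → ∀ p ∈ w.support, p ∈ K' := by
    classical
    intro v w hw p hp
    exact ⟨w.takeUntil p hp, fun q hq => hw q (w.support_takeUntil_subset_support hp hq)⟩
  refine ⟨K', ?_, ?_, ⟨⟨u, SimpleGraph.Walk.nil, by simpa using hKW hu⟩, ?_⟩, ?_⟩
  · intro v hv
    obtain ⟨w, hw⟩ := hK.2 u hu v hv
    exact ⟨w, fun p hp => hKW (hw p hp)⟩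
  · rintro v ⟨w, hw⟩
    exact hw v w.end_mem_support
  · rintro a ⟨w, hw⟩ b ⟨w', hw'⟩
    refine ⟨w.reverse.append w', fun p hp => ?_⟩
    rw [SimpleGraph.Walk.mem_support_append_iff, SimpleGraph.Walk.support_reverse,
      List.mem_reverse] at hp
    exact hp.elim (hsupp a w hw p) (hsupp b w' hw' p)
  · rw [Set.disjoint_left]
    rintro v ⟨hv, a, ⟨w, hw⟩, hav⟩ hvW
    refine hv ⟨w.concat hav, fun p hp => ?_⟩
    rw [SimpleGraph.Walk.support_concat] at hp
    simp only [List.mem_append, List.mem_singleton] at hp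
    rcases hp with hp | rfl
    · exact hw p hp
    · exact hvW

theorem WalkConnected.image {K : Set V} (hK : WalkConnected G K) (φ : G ≃g G) :
    WalkConnected G (φ '' K) := by
  refine ⟨hK.1.image _, ?_⟩
  rintro _ ⟨u, hu, rfl⟩ _ ⟨v, hv, rfl⟩
  obtain ⟨w, hw⟩ := hK.2 u hu v hv
  refine ⟨w.map φ.toHom, fun p hp => ?_⟩
  rw [SimpleGraph.Walk.support_map, List.mem_map] at hp
  obtain ⟨a, ha, rfl⟩ := hp
  exact ⟨a, hw a ha, rfl⟩

theorem nbhd_image (φ : G ≃g G) (C : Set V) : Nbhd G (φ '' C) = φ '' Nbhd G C := by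
  ext v
  constructor
  · rintro ⟨hv, _, ⟨u, hu, rfl⟩, huv⟩
    refine ⟨φ.symm v, ⟨fun h => hv ⟨_, h, φ.apply_symm_apply v⟩, u, hu, ?_⟩,
      φ.apply_symm_apply v⟩
    rw [← φ.map_adj_iff, φ.apply_symm_apply]
    exact huv
  · rintro ⟨v, ⟨hv, u, hu, huv⟩, rfl⟩
    refine ⟨?_, φ u, ⟨u, hu, rfl⟩, φ.map_adj_iff.2 huv⟩
    rintro ⟨w, hw, hwv⟩
    exact hv (φ.injective hwv ▸ hw)

theorem ContainsEnd.image {A : Set V} (h : ContainsEnd G A) (φ : G ≃g G) :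
    ContainsEnd G (φ '' A) := by
  obtain ⟨r, ⟨hi, hr⟩, hA⟩ := h
  exact ⟨fun n => φ (r n), ⟨φ.injective.comp hi, fun n => φ.map_adj_iff.2 (hr n)⟩,
    fun n => ⟨r n, hA n, rfl⟩⟩

theorem ContainsEnd.mono {A B : Set V} (h : ContainsEnd G A) (hAB : A ⊆ B) : ContainsEnd G B := by
  obtain ⟨r, hr, hA⟩ := h
  exact ⟨r, hr, fun n => hAB (hA n)⟩

/-- A set containing an end still contains a connected set with an end after deleting finitely
many vertices. -/
theorem ContainsEnd.exists_walkConnected_diff {A F : Set V} (h : ContainsEnd G A)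
    (hF : F.Finite) : ∃ K ⊆ A \ F, WalkConnected G K ∧ ContainsEnd G K := by
  obtain ⟨r, ⟨hi, hr⟩, hA⟩ := h
  obtain ⟨N, hN⟩ := (hF.preimage hi.injOn).bddAbove
  let s : ℕ → V := fun n => r (n + (N + 1))
  have hs : ∀ n, G.Adj (s n) (s (n + 1)) := fun n => by
    have := hr (n + (N + 1))
    rwa [show n + (N + 1) + 1 = n + 1 + (N + 1) by omega] at this
  have hwalk : ∀ n, ∃ w : G.Walk (s 0) (s n), ∀ p ∈ w.support, p ∈ range s := by
    intro n
    induction n with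
    | zero => exact ⟨SimpleGraph.Walk.nil, by simp⟩
    | succ n ih =>
      obtain ⟨w, hw⟩ := ih
      refine ⟨w.concat (hs n), fun p hp => ?_⟩
      rw [SimpleGraph.Walk.support_concat] at hp
      simp only [List.mem_append, List.mem_singleton] at hp
      rcases hp with hp | rfl
      · exact hw p hp
      · exact mem_range_self _
  refine ⟨range s, ?_, ⟨range_nonempty s, ?_⟩, s,
    ⟨fun a b hab => by simpa using hi hab, hs⟩, mem_range_self⟩
  · rintro _ ⟨n, rfl⟩
    refine ⟨hA _, fun hn => ?_⟩
    have : n + (N + 1) ≤ N := hN hn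
    omega
  · rintro _ ⟨m, rfl⟩ _ ⟨n, rfl⟩
    obtain ⟨w, hw⟩ := hwalk m
    obtain ⟨w', hw'⟩ := hwalk n
    refine ⟨w.reverse.append w', fun p hp => ?_⟩
    rw [SimpleGraph.Walk.mem_support_append_iff, SimpleGraph.Walk.support_reverse,
      List.mem_reverse] at hp
    exact hp.elim (hw p) (hw' p)

end Connectivity

section FullPairs

variable {V : Type u} {G : SimpleGraph V} {𝒞 : Set (Set V × Set V)} {C D C' D' : Set V}

theorem IsFullPair.symm (h : IsFullPair G 𝒞 C D) : IsFullPair G 𝒞 D C := by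
  obtain ⟨c, hc, h, hC, hD⟩ := h
  exact ⟨c, hc, h.symm, hD, hC⟩

theorem IsFullPair.connected (h : IsFullPair G 𝒞 C D) : WalkConnected G C := by
  obtain ⟨c, -, -, hC, -⟩ := h
  exact hC.1

theorem IsFullPair.containsEnd (h : IsFullPair G 𝒞 C D) : ContainsEnd G C := by
  obtain ⟨c, -, -, hC, -⟩ := h
  exact hC.2.2

theorem IsFullPair.nbhd_eq (h : IsFullPair G 𝒞 C D) : Nbhd G C = Nbhd G D := by
  obtain ⟨c, -, -, hC, hD⟩ := h
  rw [hC.2.1, hD.2.1]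

theorem IsFullPair.disjoint (h : IsFullPair G 𝒞 C D) : Disjoint C D := by
  obtain ⟨c, -, h, -⟩ := h
  rw [Set.disjoint_left]
  rcases h with ⟨rfl, h⟩ | ⟨rfl, h⟩
  · exact fun v hv hv' => hv.2 (h hv').1
  · exact fun v hv hv' => hv'.2 (h hv).1

theorem IsFullPair.notMem_nbhd (h : IsFullPair G 𝒞 C D) {v : V} (hv : v ∈ D) :
    v ∉ Nbhd G C := by
  rw [h.nbhd_eq]
  exact fun hv' => hv'.1 hv

theorem IsFullPair.not_adj (h : IsFullPair G 𝒞 C D) {u v : V} (hu : u ∈ C) (hv : v ∈ D) :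
    ¬ G.Adj u v := fun huv =>
  Set.disjoint_left.1 h.disjoint (mem_of_adj hu huv (h.notMem_nbhd hv)) hv

theorem IsFullPair.image (h𝒞 : IsBasic G 𝒞) (h : IsFullPair G 𝒞 C D) (φ : G ≃g G) :
    IsFullPair G 𝒞 (φ '' C) (φ '' D) := by
  obtain ⟨c, hc, h, ⟨hC, hNC, hEC⟩, hD, hND, hED⟩ := h
  refine ⟨(φ '' c.1, φ '' c.2), h𝒞.2.2.2.1 φ c hc, ?_, ⟨hC.image φ, ?_, hEC.image φ⟩,
    hD.image φ, ?_, hED.image φ⟩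
  · simp only [← image_sdiff φ.injective]
    exact h.imp (fun h => ⟨congrArg _ h.1, image_mono h.2⟩)
      (fun h => ⟨congrArg _ h.1, image_mono h.2⟩)
  · simp only [nbhd_image, ← image_inter φ.injective, hNC]
  · simp only [nbhd_image, ← image_inter φ.injective, hND]

theorem IsFullPair.finite_nbhd (h𝒞 : IsBasic G 𝒞) (h : IsFullPair G 𝒞 C D) :
    (Nbhd G C).Finite := by
  obtain ⟨c, hc, -, hC, -⟩ := h
  rw [hC.2.1]
  exact (h𝒞.1.2.1 c hc).2.1

theorem IsFullPair.ncard_nbhd_eq (h𝒞 : IsBasic G 𝒞) (h : IsFullPair G 𝒞 C D)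
    (h' : IsFullPair G 𝒞 C' D') : (Nbhd G C).ncard = (Nbhd G C').ncard := by
  obtain ⟨c, hc, -, hC, -⟩ := h
  obtain ⟨d, hd, -, hC', -⟩ := h'
  rw [hC.2.1, hC'.2.1]
  exact le_antisymm (not_lt.1 (h𝒞.2.1 d hd c hc)) (not_lt.1 (h𝒞.2.1 c hc d hd))

/-- A separator meets at most one of the two components. -/
theorem IsFullPair.disjoint_or (h𝒞 : IsBasic G 𝒞) (h : IsFullPair G 𝒞 C D)
    (h' : IsFullPair G 𝒞 C' D') : Disjoint (Nbhd G C') C ∨ Disjoint (Nbhd G C') D := by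
  obtain ⟨c, hc, h, -⟩ := h
  obtain ⟨d, hd, -, hC', -⟩ := h'
  obtain ⟨i, j, -, hsub⟩ := h𝒞.2.2.1 c hc d hd
  have hside : d.1 ∩ d.2 ⊆ c.1 ∨ d.1 ∩ d.2 ⊆ c.2 := by
    have := (subset_union_right.trans hsub).trans inter_subset_left
    cases i
    · exact Or.inr this
    · exact Or.inl this
  rw [hC'.2.1, Set.disjoint_left, Set.disjoint_left]
  rcases h with ⟨rfl, h⟩ | ⟨rfl, h⟩ <;> rcases hside with hs | hs
  · exact Or.inr fun v hv hv' => (h hv').2 (hs hv)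
  · exact Or.inl fun v hv hv' => hv'.2 (hs hv)
  · exact Or.inl fun v hv hv' => (h hv').2 (hs hv)
  · exact Or.inr fun v hv hv' => hv'.2 (hs hv)

/-- By minimality of the order, the neighbourhood of an end-containing component of the complement
of a separator is the whole separator. -/
theorem nbhd_eq_separator (h𝒞 : IsBasic G 𝒞) {c : Set V × Set V} (hc : c ∈ 𝒞) {K : Set V}
    (hK : Nbhd G K ⊆ c.1 ∩ c.2) (hend : ContainsEnd G K) (hend' : ContainsEnd G Kᶜ) :
    Nbhd G K = c.1 ∩ c.2 := by
  by_contra hne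
  have hfin := (h𝒞.1.2.1 c hc).2.1
  have hinter : (K ∪ Nbhd G K) ∩ Kᶜ = Nbhd G K := by
    ext v
    constructor
    · rintro ⟨h | h, h'⟩
      · exact absurd h h'
      · exact h
    · exact fun h => ⟨Or.inr h, h.1⟩
  refine (h𝒞.2.2.2.2.2 c hc).2.2 ⟨(K ∪ Nbhd G K, Kᶜ), ⟨?_, fun x y hxy => ?_⟩, ?_, ?_,
    hend.mono subset_union_left, hend'⟩
  · exact eq_univ_of_forall fun v => (em (v ∈ K)).imp Or.inl id
  · by_cases hx : x ∈ K
    · exact Or.inl ⟨Or.inl hx, (em (y ∈ K)).imp id fun hy => ⟨hy, x, hx, hxy⟩⟩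
    · by_cases hy : y ∈ K
      · exact Or.inl ⟨Or.inr ⟨hx, y, hy, hxy.symm⟩, Or.inl hy⟩
      · exact Or.inr ⟨hx, hy⟩
  · simp only [hinter]
    exact hfin.subset hK
  · simp only [hinter]
    exact Set.ncard_lt_ncard (hK.ssubset_of_ne hne) hfin

/-- A connected set with an end in the second wing of a cut extends to a component forming a full
pair with the first wing. -/
theorem exists_isFullPair (h𝒞 : IsBasic G 𝒞) {c : Set V × Set V} (hc : c ∈ 𝒞) {K : Set V}
    (hK : WalkConnected G K) (hend : ContainsEnd G K) (hsub : K ⊆ c.2 \ c.1) :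
    ∃ K', K ⊆ K' ∧ IsFullPair G 𝒞 (c.1 \ c.2) K' ∧ Nbhd G (c.1 \ c.2) = c.1 ∩ c.2 := by
  obtain ⟨⟨-, hsep⟩, hfin, -, -, hconn, -⟩ := h𝒞.1.2.1 c hc
  obtain ⟨hend₁, hend₂, -⟩ := h𝒞.2.2.2.2.2 c hc
  obtain ⟨K', hKK', hK'sub, hK', hdisj⟩ := hK.exists_component hsub
  have hendC : ContainsEnd G (c.1 \ c.2) := by
    obtain ⟨L, hL, -, hLend⟩ := hend₁.exists_walkConnected_diff hfin
    exact hLend.mono fun v hv => ⟨(hL hv).1, fun h => (hL hv).2 ⟨(hL hv).1, h⟩⟩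
  have hNC : Nbhd G (c.1 \ c.2) = c.1 ∩ c.2 := by
    refine nbhd_eq_separator h𝒞 hc ?_ hendC (hend₂.mono fun v hv h => h.2 hv)
    rintro v ⟨hv, u, hu, huv⟩
    rcases hsep u v huv with h | h
    · exact ⟨h.2, by_contra fun h' => hv ⟨h.2, h'⟩⟩
    · exact absurd h.1 hu.2
  have hNK : Nbhd G K' = c.1 ∩ c.2 := by
    refine nbhd_eq_separator h𝒞 hc ?_ (hend.mono hKK') (hend₁.mono fun v hv h => (hK'sub h).2 hv)
    intro v hvN
    obtain ⟨-, u, hu, huv⟩ := id hvN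
    rcases hsep u v huv with h | h
    · exact absurd h.1 (hK'sub hu).2
    · exact ⟨by_contra fun h' => Set.disjoint_left.1 hdisj hvN ⟨h.2, h'⟩, h.2⟩
  exact ⟨K', hKK', ⟨c, hc, Or.inl ⟨rfl, hK'sub⟩, ⟨walkConnected_of_induce hconn, hNC, hendC⟩,
    hK', hNK, hend.mono hKK'⟩, hNC⟩

theorem IsSeparatorOf.exists_isFullPair (h𝒞 : IsBasic G 𝒞) {S : Set V}
    (hS : IsSeparatorOf 𝒞 S) : ∃ C D, IsFullPair G 𝒞 C D ∧ Nbhd G C = S := by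
  obtain ⟨c, hc, rfl⟩ := hS
  obtain ⟨K, hK, hconn, hend⟩ :=
    (h𝒞.2.2.2.2.2 c hc).2.1.exists_walkConnected_diff (h𝒞.1.2.1 c hc).2.1
  have hsub : K ⊆ c.2 \ c.1 := fun v hv => ⟨(hK hv).1, fun h => (hK hv).2 ⟨h, (hK hv).1⟩⟩
  obtain ⟨K', -, hpair, hN⟩ := _root_.exists_isFullPair h𝒞 hc hconn hend hsub
  exact ⟨_, K', hpair, hN⟩

/-- A connected set with an end that avoids the separator of a full pair extends to a
component forming a full pair with one of its two members. -/
theorem IsFullPair.exists_extend (h𝒞 : IsBasic G 𝒞) (h : IsFullPair G 𝒞 C D) {K : Set V}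
    (hK : WalkConnected G K) (hend : ContainsEnd G K) (hdisj : Disjoint (Nbhd G C) K) :
    ∃ K', K ⊆ K' ∧ (IsFullPair G 𝒞 C K' ∨ IsFullPair G 𝒞 D K') := by
  wlog hwing : ∃ c ∈ 𝒞, C = c.1 \ c.2 ∧ Nbhd G C = c.1 ∩ c.2 generalizing C D
  · obtain ⟨c, hc, h₁ | h₂, hC, hD⟩ := id h
    · exact absurd ⟨c, hc, h₁.1, hC.2.1⟩ hwing
    · obtain ⟨K', hKK', h'⟩ := this h.symm (h.nbhd_eq ▸ hdisj) ⟨c, hc, h₂.1, hD.2.1⟩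
      exact ⟨K', hKK', h'.symm⟩
  by_cases hmeet : ∃ v ∈ K, v ∈ C
  · obtain ⟨v, hvK, hvC⟩ := hmeet
    exact ⟨C, hK.subset hvK hvC fun u hu hu' => Set.disjoint_left.1 hdisj hu' hu, Or.inr h.symm⟩
  · obtain ⟨c, hc, rfl, hN⟩ := hwing
    have huniv := (h𝒞.1.2.1 c hc).1.1
    obtain ⟨K', hKK', h', -⟩ := exists_isFullPair h𝒞 hc hK hend fun v hv => by
      have hv₁ : v ∉ c.1 \ c.2 := fun h => hmeet ⟨v, hv, h⟩
      have hv₂ : v ∉ c.1 ∩ c.2 := fun h => Set.disjoint_left.1 hdisj (hN ▸ h) hv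
      have hv₃ : v ∈ c.1 ∪ c.2 := huniv ▸ mem_univ v
      simp only [mem_sdiff, mem_inter_iff, mem_union] at *
      tauto
    exact ⟨K', hKK', Or.inl h'⟩

/-- There is no infinite strictly decreasing sequence of components around `a` belonging to full
pairs whose other members contain `b`. -/
theorem not_strictAnti_fullPairs (h𝒞 : IsBasic G 𝒞) {a b : V} {C D : ℕ → Set V}
    (h : ∀ n, IsFullPair G 𝒞 (C n) (D n)) (ha : ∀ n, a ∈ C n) (hb : ∀ n, b ∈ D n)
    (hC : StrictAnti C) : False := by
  have hinterval : ∀ {l m n : ℕ} {v : V}, l ≤ m → m ≤ n → v ∈ Nbhd G (C l) → v ∈ Nbhd G (C n) →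
      v ∈ Nbhd G (C m) := fun hlm hmn hl hn =>
    (nbhd_subset_union (hC.antitone hmn) hn).resolve_left fun hv => hl.1 (hC.antitone hlm hv)
  let R : Set V := {v | ∃ m, ∀ n ≥ m, v ∈ Nbhd G (C n)}
  have hRfin : ∀ F : Set V, F.Finite → F ⊆ R → ∃ m, ∀ n ≥ m, F ⊆ Nbhd G (C n) := by
    intro F hF
    induction F, hF using Set.Finite.induction_on with
    | empty => exact fun _ => ⟨0, fun n _ => empty_subset _⟩
    | @insert v F _ _ ih =>
      intro hsub
      obtain ⟨m, hm⟩ := ih ((subset_insert v F).trans hsub)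
      obtain ⟨m', hm'⟩ := hsub (mem_insert v F)
      exact ⟨max m m', fun n hn => insert_subset (hm' n (le_trans (le_max_right _ _) hn))
        (hm n (le_trans (le_max_left _ _) hn))⟩
  have hR : R.Finite := by
    by_contra hinf
    obtain ⟨F, hFR, hF, hcard⟩ := Set.Infinite.exists_subset_ncard_eq hinf
      ((Nbhd G (C 0)).ncard + 1)
    obtain ⟨m, hm⟩ := hRfin F hF hFR
    have := Set.ncard_le_ncard (hm m le_rfl) ((h m).finite_nbhd h𝒞)
    rw [(h m).ncard_nbhd_eq h𝒞 (h 0), hcard] at this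
    omega
  obtain ⟨N, hN⟩ := hRfin R hR subset_rfl
  have hRN : ∀ q ∈ Nbhd G (C N), q ∈ R := by
    intro q hq
    by_contra hqR
    obtain ⟨-, u, hu, huq⟩ := id hq
    obtain ⟨-, v, hv, hvq⟩ : q ∈ Nbhd G (D N) := (h N).nbhd_eq ▸ hq
    obtain ⟨w₁, hw₁⟩ := (h N).connected.2 a (ha N) u hu
    obtain ⟨w₂, hw₂⟩ := (h N).symm.connected.2 v hv b (hb N)
    let w : G.Walk a b := w₁.append (.cons huq (.cons hvq.symm w₂))
    have hw : ∀ p ∈ w.support, p ∈ Nbhd G (C N) → p = q := by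
      intro p hp hpN
      simp only [w, SimpleGraph.Walk.mem_support_append_iff, SimpleGraph.Walk.support_cons,
        List.mem_cons] at hp
      rcases hp with hp | rfl | rfl | hp
      · exact absurd (hw₁ p hp) hpN.1
      · exact absurd hu hpN.1
      · rfl
      · exact absurd hpN ((h N).notMem_nbhd (hw₂ p hp))
    have hmeet : ∀ n, ∃ p ∈ w.support, p ∈ Nbhd G (C n) := fun n =>
      exists_mem_support_nbhd w (ha n) fun hbn => Set.disjoint_left.1 (h n).disjoint hbn (hb n)
    choose f hf hf' using hmeet
    obtain ⟨p, hp, hpinf⟩ : ∃ p ∈ w.support, ∀ m, ∃ n ≥ m, f n = p := by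
      classical
      obtain ⟨p, hp⟩ := Finite.exists_infinite_fiber
        (fun n => (⟨f n, by simpa using hf n⟩ : w.support.toFinset))
      rw [Set.infinite_coe_iff] at hp
      refine ⟨p, List.mem_toFinset.1 p.2, fun m => ?_⟩
      obtain ⟨n, hn, hmn⟩ := hp.exists_gt m
      exact ⟨n, hmn.le, congrArg Subtype.val hn⟩
    have hpR : p ∈ R := by
      obtain ⟨m, -, hm⟩ := hpinf 0
      refine ⟨m, fun n hn => ?_⟩
      obtain ⟨n', hn', hp'⟩ := hpinf n
      exact hinterval hn hn' (hm ▸ hf' m) (hp' ▸ hf' n')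
    exact hqR (hw p hp (hN N le_rfl hpR) ▸ hpR)
  have heq : Nbhd G (C N) = Nbhd G (C (N + 1)) :=
    Set.eq_of_subset_of_ncard_le (fun q hq => hN (N + 1) (by omega) (hRN q hq))
      ((h (N + 1)).ncard_nbhd_eq h𝒞 (h N)).le ((h (N + 1)).finite_nbhd h𝒞)
  have hlt : C (N + 1) < C N := hC (Nat.lt_succ_self N)
  refine hlt.not_ge ((h N).connected.subset (ha N) (ha (N + 1)) fun v hv hv' => ?_)
  rw [← heq] at hv'
  exact hv'.1 hv

/-- Transitivity properties of automorphisms fixing a vertex `x`, for a relation `R` such as the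
edge relation of a C-homogeneous digraph or its converse. -/
def StarTransitive {V : Type u} (G : SimpleGraph V) (R : V → V → Prop) : Prop :=
  (∀ x a b, R x a → R x b → ∃ φ : G ≃g G, φ x = x ∧ φ a = b ∧ ∀ v, R x v → R x (φ v)) ∧
  ∀ x a b c, R x a → R x b → R x c → a ≠ b → a ≠ c → ¬ G.Adj a b → ¬ G.Adj a c →
    ∃ φ : G ≃g G, φ x = x ∧ φ a = a ∧ φ b = c

theorem IsFullPair.adj_of_starTransitive (h𝒞 : IsBasic G 𝒞) {R : V → V → Prop}
    (hR : StarTransitive G R) (h : IsFullPair G 𝒞 C D) {x a b q : V} (hq : q ∈ Nbhd G C)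
    (hxq : R x q) (ha : a ∈ C) (hxa : R x a) (hb : b ∈ D) (hxb : R x b) : G.Adj a q := by
  by_contra hadj
  obtain ⟨φ, -, hφa, hφb⟩ := hR.2 x a b q hxa hxb hxq
    (fun hab => Set.disjoint_left.1 h.disjoint ha (hab ▸ hb)) (fun haq => hq.1 (haq ▸ ha))
    (h.not_adj ha hb) hadj
  have h' := h.image h𝒞 φ
  have ha' : a ∈ φ '' C := ⟨a, ha, hφa⟩
  have hq' : q ∈ φ '' D := ⟨b, hb, hφb⟩
  have hqD : q ∈ Nbhd G D := h.nbhd_eq ▸ hq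
  have hdisj : Disjoint (Nbhd G (φ '' C)) D := by
    refine (h.disjoint_or h𝒞 h').resolve_left fun hdisj => ?_
    have hsub : C ⊆ φ '' C :=
      h.connected.subset ha ha' fun v hv hv' => Set.disjoint_left.1 hdisj hv' hv
    exact (nbhd_subset_union hsub hq).elim (fun hqC => Set.disjoint_left.1 h'.disjoint hqC hq')
      (h'.notMem_nbhd hq')
  have hD : D ⊆ φ '' D := by
    obtain ⟨-, u, hu, huq⟩ := hqD
    have hnot : ∀ v ∈ D, v ∉ Nbhd G (φ '' D) := fun v hv hv' =>
      Set.disjoint_left.1 hdisj (h'.nbhd_eq ▸ hv') hv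
    exact h.symm.connected.subset hu (mem_of_adj hq' huq.symm (hnot u hu)) hnot
  have hC : φ '' C ⊆ C := by
    refine h'.connected.subset ha' ha fun v hv hv' => ?_
    rw [h.nbhd_eq] at hv'
    exact (nbhd_subset_union hD hv').elim (fun hvD => Set.disjoint_left.1 h'.disjoint hv hvD)
      (h'.symm.notMem_nbhd hv)
  have hne : φ '' C ≠ C := fun heq => h'.notMem_nbhd hq' (heq.symm ▸ hq)
  have hinj : Function.Injective (fun A : Set V => φ '' A) := φ.injective.image_injective
  let Cs : ℕ → Set V := fun n => (fun A : Set V => φ '' A)^[n] C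
  let Ds : ℕ → Set V := fun n => (fun A : Set V => φ '' A)^[n] D
  have hCs : ∀ n, Cs (n + 1) = φ '' Cs n := fun n => Function.iterate_succ_apply' _ n C
  have hDs : ∀ n, Ds (n + 1) = φ '' Ds n := fun n => Function.iterate_succ_apply' _ n D
  refine not_strictAnti_fullPairs h𝒞 (a := a) (b := b) (C := Cs) (D := Ds) (fun n => ?_)
    (fun n => ?_) (fun n => ?_) (strictAnti_nat_of_succ_lt fun n => ?_)
  · induction n with
    | zero => exact h
    | succ n ih => rw [hCs, hDs]; exact ih.image h𝒞 φ
  · induction n with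
    | zero => exact ha
    | succ n ih => rw [hCs]; exact ⟨a, ih, hφa⟩
  · have : D ⊆ Ds n := by
      induction n with
      | zero => exact subset_rfl
      | succ n ih => rw [hDs]; exact hD.trans (image_mono ih)
    exact this hb
  · induction n with
    | zero => exact hC.lt_of_ne hne
    | succ n ih =>
      rw [hCs (n + 1), hCs n]
      rw [hCs n] at ih
      exact (image_mono ih.le).lt_of_ne fun heq => ih.ne (hinj heq)

/-- A separator containing `x` and some `q` with `R x q` does not separate two such vertices. -/
theorem IsFullPair.not_separates (h𝒞 : IsBasic G 𝒞) {R : V → V → Prop}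
    (hR : StarTransitive G R) (h : IsFullPair G 𝒞 C D) {x a b q : V} (hq : q ∈ Nbhd G C)
    (hxq : R x q) (ha : a ∈ C) (hxa : R x a) (hb : b ∈ D) (hxb : R x b) : False := by
  obtain ⟨φ, hφx, hφq, hφR⟩ := hR.1 x q a hxq hxa
  have h' := h.image h𝒞 φ
  have ha' : a ∈ Nbhd G (φ '' C) := by
    rw [nbhd_image]
    exact ⟨q, hq, hφq⟩
  have hdisj : Disjoint (Nbhd G (φ '' C)) D :=
    (h.disjoint_or h𝒞 h').resolve_left fun hd => Set.disjoint_left.1 hd ha' ha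
  obtain ⟨K, hDK, hK⟩ := h'.exists_extend h𝒞 h.symm.connected h.symm.containsEnd hdisj
  refine h.not_adj ha hb (SimpleGraph.Adj.symm ?_)
  rcases hK with hK | hK
  · exact hK.symm.adj_of_starTransitive h𝒞 hR (hK.nbhd_eq ▸ ha') hxa (hDK hb) hxb
      ⟨a, ha, rfl⟩ (hφR a hxa)
  · exact hK.symm.adj_of_starTransitive h𝒞 hR (hK.nbhd_eq ▸ h'.nbhd_eq ▸ ha') hxa (hDK hb) hxb
      ⟨b, hb, rfl⟩ (hφR b hxb)

end FullPairs

section Homogeneity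

variable {V : Type u} {E : V → V → Prop}

theorem UG_adj (hD : IsDigraph E) {x y : V} : (UG E).Adj x y ↔ E x y ∨ E y x := by
  rw [UG, SimpleGraph.fromRel_adj, and_iff_right_iff_imp]
  rintro h rfl
  exact hD.1 x (or_self_iff.1 h)

/-- In a C-homogeneous digraph, isomorphisms between finite stars with arbitrary edges between
the leaves extend to automorphisms. -/
theorem DigraphCHom.exists_iso (hhom : DigraphCHom E) {n : ℕ} {f g : Fin (n + 1) → V}
    (hf : Function.Injective f) (hg : Function.Injective g)
    (hadj : ∀ i, i ≠ 0 → (UG E).Adj (f 0) (f i))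
    (hfg : ∀ i j, E (f i) (f j) ↔ E (g i) (g j)) :
    ∃ φ : UG E ≃g UG E, (∀ x y, E (φ x) (φ y) ↔ E x y) ∧ ∀ i, φ (f i) = g i := by
  have hconn : ((UG E).induce (range f)).Connected := by
    rw [SimpleGraph.connected_iff_exists_forall_reachable]
    refine ⟨⟨f 0, mem_range_self 0⟩, ?_⟩
    rintro ⟨_, i, rfl⟩
    by_cases hi : i = 0
    · subst hi
      exact SimpleGraph.Reachable.refl _
    · exact SimpleGraph.Adj.reachable (hadj i hi)
  let θ : range f ≃ range g := (Equiv.ofInjective f hf).symm.trans (Equiv.ofInjective g hg)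
  have hθ : ∀ i, (θ ⟨f i, mem_range_self i⟩ : V) = g i := fun i => by
    have : (Equiv.ofInjective f hf).symm ⟨f i, mem_range_self i⟩ = i :=
      Equiv.ofInjective_symm_apply hf i
    simp only [θ, Equiv.trans_apply, this, Equiv.ofInjective_apply]
  obtain ⟨ψ, hψ, hψθ⟩ := hhom _ _ (finite_range f) (finite_range g) hconn θ (by
    rintro ⟨_, i, rfl⟩ ⟨_, j, rfl⟩
    rw [hθ, hθ]
    exact hfg i j)
  refine ⟨⟨ψ, ?_⟩, hψ, fun i => (hψθ ⟨f i, mem_range_self i⟩).trans (hθ i)⟩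
  intro x y
  simp only [UG, SimpleGraph.fromRel_adj, hψ, ψ.injective.ne_iff]

theorem DigraphCHom.exists_iso_edge (hD : IsDigraph E) (hhom : DigraphCHom E) {x y x' y' : V}
    (h : E x y) (h' : E x' y') :
    ∃ φ : UG E ≃g UG E, (∀ x y, E (φ x) (φ y) ↔ E x y) ∧ φ x = x' ∧ φ y = y' := by
  have hne : ∀ {x y}, E x y → x ≠ y := fun h hxy => hD.1 _ (hxy ▸ h)
  obtain ⟨φ, hφ, hφi⟩ := hhom.exists_iso (f := ![x, y]) (g := ![x', y'])
    (by simpa [Fin.forall_fin_two, Function.Injective] using ⟨hne h, (hne h).symm⟩)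
    (by simpa [Fin.forall_fin_two, Function.Injective] using ⟨hne h', (hne h').symm⟩)
    (by simpa [Fin.forall_fin_two] using (UG_adj hD).2 (Or.inl h))
    (by simp [Fin.forall_fin_two, hD.1, h, h', hD.2 _ _ h, hD.2 _ _ h'])
  exact ⟨φ, hφ, hφi 0, hφi 1⟩

theorem DigraphCHom.exists_iso_fork (hD : IsDigraph E) (hhom : DigraphCHom E) {x a b c : V}
    (ha : (UG E).Adj x a) (hb : (UG E).Adj x b) (hc : (UG E).Adj x c) (hab : a ≠ b) (hac : a ≠ c)
    (hnab : ¬ (UG E).Adj a b) (hnac : ¬ (UG E).Adj a c) (hbc : E x b ↔ E x c)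
    (hcb : E b x ↔ E c x) :
    ∃ φ : UG E ≃g UG E, φ x = x ∧ φ a = a ∧ φ b = c := by
  rw [UG_adj hD, not_or] at hnab hnac
  obtain ⟨φ, -, hφi⟩ := hhom.exists_iso (f := ![x, a, b]) (g := ![x, a, c])
    (by simp [Fin.forall_fin_succ, Function.Injective, ha.ne, ha.ne', hb.ne, hb.ne', hab,
      hab.symm])
    (by simp [Fin.forall_fin_succ, Function.Injective, ha.ne, ha.ne', hc.ne, hc.ne', hac,
      hac.symm])
    (by simp [Fin.forall_fin_succ, ha, hb])
    (by simp [Fin.forall_fin_succ, hD.1, hnab, hnac, hbc, hcb])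
  exact ⟨φ, hφi 0, hφi 1, hφi 2⟩

theorem DigraphCHom.starTransitive (hD : IsDigraph E) (hhom : DigraphCHom E) :
    StarTransitive (UG E) E := by
  refine ⟨fun x a b ha hb => ?_, fun x a b c ha hb hc hab hac hnab hnac => ?_⟩
  · obtain ⟨φ, hφ, hx, ha⟩ := hhom.exists_iso_edge hD ha hb
    refine ⟨φ, hx, ha, fun v hv => ?_⟩
    rw [← hφ, hx] at hv
    exact hv
  · exact hhom.exists_iso_fork hD ((UG_adj hD).2 (Or.inl ha)) ((UG_adj hD).2 (Or.inl hb))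
      ((UG_adj hD).2 (Or.inl hc)) hab hac hnab hnac (iff_of_true hb hc)
      (iff_of_false (hD.2 _ _ hb) (hD.2 _ _ hc))

theorem DigraphCHom.starTransitive_swap (hD : IsDigraph E) (hhom : DigraphCHom E) :
    StarTransitive (UG E) (fun x y => E y x) := by
  refine ⟨fun x a b ha hb => ?_, fun x a b c ha hb hc hab hac hnab hnac => ?_⟩
  · obtain ⟨φ, hφ, ha, hx⟩ := hhom.exists_iso_edge hD ha hb
    refine ⟨φ, hx, ha, fun v (hv : E v x) => ?_⟩
    rw [← hφ, hx] at hv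
    exact hv
  · exact hhom.exists_iso_fork hD ((UG_adj hD).2 (Or.inr ha)) ((UG_adj hD).2 (Or.inr hb))
      ((UG_adj hD).2 (Or.inr hc)) hab hac hnab hnac
      (iff_of_false (hD.2 _ _ hb) (hD.2 _ _ hc)) (iff_of_true hb hc)

/-- If every edge into `x` lies in a separator and `C` contains no out-neighbour of `x`, there is
a full pair of the same kind whose separator contains more in-neighbours of `x`. -/
theorem IsFullPair.exists_more_inNeighbours {𝒞 : Set (Set V × Set V)} (hD : IsDigraph E)
    (hhom : DigraphCHom E) (h𝒞 : IsBasic (UG E) 𝒞) {x : V}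
    (hsep : ∀ z, E z x → ∃ C D, IsFullPair (UG E) 𝒞 C D ∧ z ∈ Nbhd (UG E) C ∧ x ∈ Nbhd (UG E) C)
    {C D : Set V} (h : IsFullPair (UG E) 𝒞 C D) (hx : x ∈ Nbhd (UG E) C)
    (hout : ∀ v ∈ C, ¬ E x v) :
    ∃ C' D', IsFullPair (UG E) 𝒞 C' D' ∧ x ∈ Nbhd (UG E) C' ∧ (∀ v ∈ C', ¬ E x v) ∧
      (Nbhd (UG E) C ∩ {z | E z x}).ncard < (Nbhd (UG E) C' ∩ {z | E z x}).ncard := by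
  have hin : ∀ {K : Set V}, x ∈ Nbhd (UG E) K → (∀ v ∈ K, ¬ E x v) → ∃ z ∈ K, E z x := by
    rintro K ⟨-, z, hz, hzx⟩ hK
    exact ⟨z, hz, ((UG_adj hD).1 hzx).resolve_right (hK z hz)⟩
  obtain ⟨z, hzC, hzx⟩ := hin hx hout
  obtain ⟨A, B, hAB, hzA, hxA⟩ := hsep z hzx
  have hdisj : Disjoint (Nbhd (UG E) A) D :=
    (h.disjoint_or h𝒞 hAB).resolve_left fun hd => Set.disjoint_left.1 hd hzA hzC
  obtain ⟨K, C', hDK, hK, hNK⟩ : ∃ K C', D ⊆ K ∧ IsFullPair (UG E) 𝒞 C' K ∧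
      Nbhd (UG E) C' = Nbhd (UG E) A := by
    obtain ⟨K, hDK, hK | hK⟩ := hAB.exists_extend h𝒞 h.symm.connected h.symm.containsEnd hdisj
    · exact ⟨K, A, hDK, hK, rfl⟩
    · exact ⟨K, B, hDK, hK, hAB.nbhd_eq.symm⟩
  rw [← hNK] at hzA hxA
  have hN : Nbhd (UG E) C ⊆ K ∪ Nbhd (UG E) C' := by
    rw [h.nbhd_eq, hK.nbhd_eq]
    exact nbhd_subset_union hDK
  have havoid : ∀ v ∈ C', v ∉ Nbhd (UG E) C := fun v hv hv' =>
    (hN hv').elim (fun hvK => Set.disjoint_left.1 hK.disjoint hv hvK) (fun hv' => hv'.1 hv)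
  have hsub : C' ⊆ C := by
    obtain ⟨-, u, hu, huz⟩ := hzA
    exact hK.connected.subset hu (mem_of_adj hzC huz.symm (havoid u hu)) havoid
  have hout' : ∀ v ∈ C', ¬ E x v := fun v hv => hout v (hsub hv)
  obtain ⟨z', hz'C, hz'x⟩ := hin hxA hout'
  refine ⟨C', K, hK, hxA, hout', Set.ncard_lt_ncard ?_ ((hK.finite_nbhd h𝒞).inter_of_left _)⟩
  rw [Set.ssubset_iff_of_subset]
  · exact ⟨z, ⟨hzA, hzx⟩, fun hz => hz.1.1 hzC⟩
  · rintro v ⟨hvN, hvx⟩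
    exact ⟨(hN hvN).resolve_left fun hvK => hK.not_separates h𝒞 (hhom.starTransitive_swap hD)
      hzA hzx hz'C hz'x hvK hvx, hvx⟩

end Homogeneity

/-- No edge of a connected C-homogeneous digraph with more than one end has both
endvertices in a separator of a basic cut system. -/
theorem stmt_1 {V : Type u} (E : V → V → Prop) (hD : IsDigraph E)
    (hconn : (UG E).Connected) (hhom : DigraphCHom E)
    (hends : MoreThanOneEnd (UG E))
    (𝒞 : Set (Set V × Set V)) (h𝒞 : IsBasic (UG E) 𝒞)
    (S : Set V) (hS : IsSeparatorOf 𝒞 S) :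
    ∀ x ∈ S, ∀ y ∈ S, ¬ E x y := by
  intro x hx y hy hxy
  obtain ⟨C, D, h, rfl⟩ := hS.exists_isFullPair h𝒞
  have hsep : ∀ z, E z x → ∃ C D, IsFullPair (UG E) 𝒞 C D ∧ z ∈ Nbhd (UG E) C ∧
      x ∈ Nbhd (UG E) C := by
    intro z hzx
    obtain ⟨φ, -, hφx, hφy⟩ := hhom.exists_iso_edge hD hxy hzx
    refine ⟨_, _, h.image h𝒞 φ, ?_⟩
    rw [nbhd_image]
    exact ⟨⟨x, hx, hφx⟩, ⟨y, hy, hφy⟩⟩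
  have hstart : ∃ C D, IsFullPair (UG E) 𝒞 C D ∧ x ∈ Nbhd (UG E) C ∧ ∀ v ∈ C, ¬ E x v := by
    by_cases hC : ∀ v ∈ C, ¬ E x v
    · exact ⟨C, D, h, hx, hC⟩
    · push Not at hC
      obtain ⟨a, ha, hxa⟩ := hC
      exact ⟨D, C, h.symm, h.nbhd_eq ▸ hx, fun b hb hxb =>
        h.not_separates h𝒞 (hhom.starTransitive hD) hy hxy ha hxa hb hxb⟩
  have hmany : ∀ n : ℕ, ∃ C' D', IsFullPair (UG E) 𝒞 C' D' ∧ x ∈ Nbhd (UG E) C' ∧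
      (∀ v ∈ C', ¬ E x v) ∧ n ≤ (Nbhd (UG E) C' ∩ {z | E z x}).ncard := by
    intro n
    induction n with
    | zero =>
      obtain ⟨C', D', h', hx', hout⟩ := hstart
      exact ⟨C', D', h', hx', hout, Nat.zero_le _⟩
    | succ n ih =>
      obtain ⟨C', D', h', hx', hout, hn⟩ := ih
      obtain ⟨C'', D'', h'', hx'', hout', hlt⟩ :=
        h'.exists_more_inNeighbours hD hhom h𝒞 hsep hx' hout
      exact ⟨C'', D'', h'', hx'', hout', hn.trans_lt hlt⟩
  obtain ⟨C', D', h', -, -, hcard⟩ := hmany ((Nbhd (UG E) C).ncard + 1)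
  have hle := Set.ncard_le_ncard (inter_subset_left (t := {z | E z x})) (h'.finite_nbhd h𝒞)
  rw [h'.ncard_nbhd_eq h𝒞 h] at hle
  omega
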